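/- arXiv:2312.11113 — 2 statements merged into one kernel-verified Lean document; each statement's English description precedes it below -/
import Mathlib

section
/- Let (T, ⪯, f) be an order-theoretic merge tree in which any two points have a least upper bound and every point has a leaf below it, equipped with a leaf-order ⊑_L. Let (≤_h) be the layer-order induced by ⊑_L, and let ⊑'_L be the leaf-order induced by (≤_h). Then ⊑'_L equals ⊑_L: for all leaves u1, u2 of T, u1 ⊑_L u2 if and only if u1 ⊑'_L u2. -/
/-- An order-theoretic merge tree: a partially ordered set with a real-valued
height function that is strictly monotone, whose ancestors form chains, and in
which every point can be lifted to any height above it. `up x h` is the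
(necessarily unique) ancestor of `x` at height `h` (for `f x ≤ h`). -/
structure MergeTree (T : Type*) [PartialOrder T] where
  f : T → ℝ
  up : T → ℝ → T
  strict_mono : ∀ {x y : T}, x < y → f x < f y
  chain : ∀ {x y z : T}, x ≤ y → x ≤ z → y ≤ z ∨ z ≤ y
  le_up : ∀ (x : T) (h : ℝ), f x ≤ h → x ≤ up x h
  f_up : ∀ (x : T) (h : ℝ), f x ≤ h → f (up x h) = h

/-- A consistent layer-order on a merge tree: for every height `h`, a total
order on the level set `T_h = {x | f x = h}`, consistent with lifting. -/
structure LayerOrder {T : Type*} [PartialOrder T] (M : MergeTree T) where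
  le : ℝ → T → T → Prop
  refl : ∀ (h : ℝ) (x : T), M.f x = h → le h x x
  antisymm : ∀ (h : ℝ) (x y : T), M.f x = h → M.f y = h → le h x y → le h y x → x = y
  trans : ∀ (h : ℝ) (x y z : T), M.f x = h → M.f y = h → M.f z = h →
    le h x y → le h y z → le h x z
  total : ∀ (h : ℝ) (x y : T), M.f x = h → M.f y = h → le h x y ∨ le h y x
  consistent : ∀ (h₁ h₂ : ℝ), h₁ ≤ h₂ → ∀ (x y : T), M.f x = h₁ → M.f y = h₁ →
    le h₁ x y → le h₂ (M.up x h₂) (M.up y h₂)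

/-- A leaf of a merge tree is a minimal element. -/
def IsLeaf {T : Type*} [PartialOrder T] (x : T) : Prop := ∀ y : T, y ≤ x → y = x

/-- A leaf-order on a merge tree whose underlying order has binary least upper
bounds (`⊔` = lca): a total order on the leaves that separates subtrees. -/
structure LeafOrder (T : Type*) [SemilatticeSup T] where
  le : T → T → Prop
  refl : ∀ u : T, IsLeaf u → le u u
  antisymm : ∀ u v : T, IsLeaf u → IsLeaf v → le u v → le v u → u = v
  trans : ∀ u v w : T, IsLeaf u → IsLeaf v → IsLeaf w → le u v → le v w → le u w
  total : ∀ u v : T, IsLeaf u → IsLeaf v → le u v ∨ le v u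
  separates : ∀ u u1 u2 : T, IsLeaf u → IsLeaf u1 → IsLeaf u2 →
    le u1 u → le u u2 → u ≤ u1 ⊔ u2

/-- The layer relation induced by a relation `lle` on leaves:
`x1 ≤ x2` iff `x1 = x2` or every leaf below `x1` is `lle`-below every leaf
below `x2` (i.e. `L(T_{x1}) ⊑_L L(T_{x2})`). -/
def inducedLayerLe {T : Type*} [PartialOrder T] (lle : T → T → Prop)
    (x1 x2 : T) : Prop :=
  x1 = x2 ∨ ∀ u1 : T, IsLeaf u1 → u1 ≤ x1 → ∀ u2 : T, IsLeaf u2 → u2 ≤ x2 → lle u1 u2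

/-- The leaf-order on leaves induced by a layer-order:
`u1 ⊑'_L u2` iff `u1^h ≤_h u2^h` where `h = max (f u1) (f u2)`. -/
def inducedLeafLe {T : Type*} [PartialOrder T] (M : MergeTree T)
    (lay : ℝ → T → T → Prop) (u1 u2 : T) : Prop :=
  lay (max (M.f u1) (M.f u2))
    (M.up u1 (max (M.f u1) (M.f u2))) (M.up u2 (max (M.f u1) (M.f u2)))

namespace MergeTree

variable {T : Type*}

theorem eq_of_le_of_f_eq [PartialOrder T] (M : MergeTree T) {x y : T} (hxy : x ≤ y)
    (hf : M.f x = M.f y) : x = y :=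
  hxy.eq_of_not_lt fun h => (M.strict_mono h).ne hf

theorem eq_of_common_lower [PartialOrder T] (M : MergeTree T) {u x y : T} (hx : u ≤ x)
    (hy : u ≤ y) (hf : M.f x = M.f y) : x = y :=
  (M.chain hx hy).elim (fun h => M.eq_of_le_of_f_eq h hf)
    fun h => (M.eq_of_le_of_f_eq h hf.symm).symm

theorem up_f_self [PartialOrder T] (M : MergeTree T) (x : T) : M.up x (M.f x) = x :=
  (M.eq_of_le_of_f_eq (M.le_up x _ le_rfl) (M.f_up x _ le_rfl).symm).symm

/-- Two leaves whose lifts to the larger of their heights agree are equal. -/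
theorem leaf_eq_of_up_max_eq [PartialOrder T] (M : MergeTree T) {u v : T} (hu : IsLeaf u)
    (hv : IsLeaf v) (h : M.up u (max (M.f u) (M.f v)) = M.up v (max (M.f u) (M.f v))) :
    u = v := by
  have hu' := M.le_up u _ (le_max_left (M.f u) (M.f v))
  have hv' := M.le_up v _ (le_max_right (M.f u) (M.f v))
  rcases le_total (M.f u) (M.f v) with hle | hle
  · rw [h, max_eq_right hle, up_f_self] at hu'
    exact hv u hu'
  · rw [← h, max_eq_left hle, up_f_self] at hv'
    exact (hu v hv').symm

/-- A leaf-order compares all leaves below two distinct points of equal height in the same way. -/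
theorem leafOrder_le_of_le [SemilatticeSup T] (M : MergeTree T) (lo : LeafOrder T)
    {x y u v u' v' : T} (hf : M.f x = M.f y) (hne : x ≠ y)
    (hu : IsLeaf u) (hv : IsLeaf v) (hu' : IsLeaf u') (hv' : IsLeaf v')
    (hux : u ≤ x) (hvy : v ≤ y) (hux' : u' ≤ x) (hvy' : v' ≤ y) (h : lo.le u v) :
    lo.le u' v' := by
  have h₁ : lo.le u' v := (lo.total u' v hu' hv).resolve_right fun hvu =>
    hne <| M.eq_of_common_lower
      ((lo.separates v u u' hv hu hu' h hvu).trans (sup_le hux hux')) hvy hf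
  exact (lo.total u' v' hu' hv').resolve_right fun hvu =>
    hne <| M.eq_of_common_lower hux'
      ((lo.separates u' v' v hu' hv' hv hvu h₁).trans (sup_le hvy' hvy)) hf

end MergeTree

/-- Starting from a leaf-order `⊑_L`, taking the induced
layer-order and then the induced leaf-order recovers `⊑_L`: for all leaves
`u1, u2`, `u1 ⊑_L u2 ↔ u1 ⊑'_L u2`. -/
theorem leaf_to_layer_to_leaf {T : Type*} [SemilatticeSup T]
    (M : MergeTree T) (lo : LeafOrder T)
    (hleaf : ∀ x : T, ∃ u : T, IsLeaf u ∧ u ≤ x)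
    (u1 u2 : T) (h1 : IsLeaf u1) (h2 : IsLeaf u2) :
    lo.le u1 u2 ↔ inducedLeafLe M (fun _ x y => inducedLayerLe lo.le x y) u1 u2 := by
  have hm₁ := le_max_left (M.f u1) (M.f u2)
  have hm₂ := le_max_right (M.f u1) (M.f u2)
  constructor
  · intro h
    by_cases he : M.up u1 (max (M.f u1) (M.f u2)) = M.up u2 (max (M.f u1) (M.f u2))
    · exact Or.inl he
    · exact Or.inr fun v1 hv1 hle1 v2 hv2 hle2 =>
        M.leafOrder_le_of_le lo ((M.f_up u1 _ hm₁).trans (M.f_up u2 _ hm₂).symm) he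
          h1 h2 hv1 hv2 (M.le_up u1 _ hm₁) (M.le_up u2 _ hm₂) hle1 hle2 h
  · rintro (he | h)
    · obtain rfl := M.leaf_eq_of_up_max_eq h1 h2 he
      exact lo.refl _ h1
    · exact h u1 h1 (M.le_up u1 _ hm₁) u2 h2 (M.le_up u2 _ hm₂)
end

section
/- Let (T, ⪯, f, (≤_h)) and (T', ⪯', f', (≤'_h)) be order-theoretic ordered merge trees, each in which any two points have a least upper bound and every point has a leaf below it, let δ ≥ 0, and suppose there exists a monotone δ-labelling (π, π') of some size n between T and T'. Then there exist maps α : T → T' and β : T' → T such that: (1) f'(α(x)) = f(x) + δ for all x ∈ T and f(β(y)) = f'(y) + δ for all y ∈ T'; (2) α and β are order-preserving (x1 ⪯ x2 implies α(x1) ⪯' α(x2), and y1 ⪯' y2 implies β(y1) ⪯ β(y2)); (3) β(α(x)) = x^{f(x)+2δ} for all x ∈ T and α(β(y)) = y^{f'(y)+2δ} for all y ∈ T'; and (4) α and β are layer-monotone: for all h and x1, x2 ∈ T_h, x1 ≤_h x2 implies α(x1) ≤'_{h+δ} α(x2), and for all h and y1, y2 ∈ T'_h, y1 ≤'_h y2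 implies β(y1) ≤_{h+δ} β(y2). -/
/-- The order `⊑` on arbitrary points of an ordered merge tree:
`x1 ⊑ x2` iff `x1^h ≤_h x2^h` where `h = max (f x1) (f x2)`. -/
def ptLe {T : Type*} [PartialOrder T] (M : MergeTree T) (L : LayerOrder M)
    (x1 x2 : T) : Prop :=
  L.le (max (M.f x1) (M.f x2))
    (M.up x1 (max (M.f x1) (M.f x2))) (M.up x2 (max (M.f x1) (M.f x2)))

namespace MergeTree

section PartialOrder

variable {T : Type*} [PartialOrder T] (M : MergeTree T)

theorem f_mono {x y : T} (h : x ≤ y) : M.f x ≤ M.f y := by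
  rcases h.eq_or_lt with rfl | h
  · exact le_rfl
  · exact (M.strict_mono h).le

theorem le_of_f_le {x y z : T} (hy : x ≤ y) (hz : x ≤ z) (h : M.f y ≤ M.f z) : y ≤ z := by
  rcases M.chain hy hz with hyz | hzy
  · exact hyz
  · rcases hzy.eq_or_lt with rfl | hlt
    · exact le_rfl
    · exact absurd (M.strict_mono hlt) h.not_gt

theorem eq_of_f_eq {x y z : T} (hy : x ≤ y) (hz : x ≤ z) (h : M.f y = M.f z) : y = z :=
  le_antisymm (M.le_of_f_le hy hz h.le) (M.le_of_f_le hz hy h.ge)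

theorem up_eq {x y : T} {h : ℝ} (hxy : x ≤ y) (hy : M.f y = h) : M.up x h = y := by
  have hx : M.f x ≤ h := hy ▸ M.f_mono hxy
  exact M.eq_of_f_eq (M.le_up x h hx) hxy ((M.f_up x h hx).trans hy.symm)

theorem up_up {x : T} {h₁ h₂ : ℝ} (hx : M.f x ≤ h₁) (h : h₁ ≤ h₂) :
    M.up (M.up x h₁) h₂ = M.up x h₂ := by
  have hf : M.f (M.up x h₁) ≤ h₂ := (M.f_up x h₁ hx).trans_le h
  exact (M.up_eq ((M.le_up x h₁ hx).trans (M.le_up _ h₂ hf)) (M.f_up _ h₂ hf)).symm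

variable {M} (L : LayerOrder M)

theorem ptLe_total (x y : T) : ptLe M L x y ∨ ptLe M L y x := by
  unfold ptLe
  rw [max_comm (M.f y) (M.f x)]
  exact L.total _ _ _ (M.f_up _ _ (le_max_left _ _)) (M.f_up _ _ (le_max_right _ _))

theorem le_up_of_ptLe {x y : T} {h : ℝ} (hx : M.f x ≤ h) (hy : M.f y ≤ h)
    (hxy : ptLe M L x y) : L.le h (M.up x h) (M.up y h) := by
  have hc := L.consistent _ h (max_le hx hy) _ _ (M.f_up _ _ (le_max_left _ _))
    (M.f_up _ _ (le_max_right _ _)) hxy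
  rwa [M.up_up (le_max_left _ _) (max_le hx hy), M.up_up (le_max_right _ _) (max_le hx hy)] at hc

/-- Points below distinct points of a common level are strictly ordered as those are. -/
theorem not_ptLe_of_le {x y u v : T} {h : ℝ} (hx : M.f x = h) (hy : M.f y = h)
    (hle : L.le h x y) (hne : x ≠ y) (hu : u ≤ x) (hv : v ≤ y) : ¬ ptLe M L v u := by
  intro hvu
  have h' := le_up_of_ptLe L (hy ▸ M.f_mono hv) (hx ▸ M.f_mono hu) hvu
  rw [M.up_eq hv hy, M.up_eq hu hx] at h'
  exact hne (L.antisymm h x y hx hy hle h')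

theorem exists_label_le {ι : Type*} {π : ι → T} (hleaf : ∀ x : T, ∃ u : T, IsLeaf u ∧ u ≤ x)
    (hπ : ∀ u : T, IsLeaf u → ∃ i, π i = u) (x : T) : ∃ i, π i ≤ x := by
  obtain ⟨u, hu, hux⟩ := hleaf x
  obtain ⟨i, rfl⟩ := hπ u hu
  exact ⟨i, hux⟩

end PartialOrder

section Shift

variable {T T' ι : Type*} [SemilatticeSup T] [SemilatticeSup T'] {M : MergeTree T}
  {M' : MergeTree T'} (L : LayerOrder M) (L' : LayerOrder M') {δ : ℝ} {π : ι → T} {π' : ι → T'}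

/-- Labels on two ordered merge trees whose order and lowest common ancestors are controlled in
one direction induce a layer-monotone `δ`-shift map, sending a point above the `i`-th label
to a point above the `i`-th label. -/
theorem exists_shift (hπ : ∀ x, ∃ i, π i ≤ x)
    (hlca : ∀ i j, M'.f (π' i ⊔ π' j) ≤ M.f (π i ⊔ π j) + δ)
    (hmono : ∀ i j, ¬ ptLe M L (π j) (π i) → ptLe M' L' (π' i) (π' j)) :
    ∃ α : T → T', (∀ x, M'.f (α x) = M.f x + δ) ∧ (∀ x i, π i ≤ x → π' i ≤ α x) ∧
      (∀ x₁ x₂, x₁ ≤ x₂ → α x₁ ≤ α x₂) ∧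
      ∀ (h : ℝ) (x₁ x₂ : T), M.f x₁ = h → M.f x₂ = h → L.le h x₁ x₂ →
        L'.le (h + δ) (α x₁) (α x₂) := by
  choose c hc using hπ
  have hlow : ∀ x i, π i ≤ x → M'.f (π' i) ≤ M.f x + δ := fun x i hi => by
    have h := hlca i i
    rw [sup_idem, sup_idem] at h
    linarith [M.f_mono hi]
  set α : T → T' := fun x => M'.up (π' (c x)) (M.f x + δ) with hα
  have hf : ∀ x, M'.f (α x) = M.f x + δ := fun x => M'.f_up _ _ (hlow x _ (hc x))
  have hbelow : ∀ x i, π i ≤ x → π' i ≤ α x := fun x i hi => by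
    have hsup : M'.f (π' i ⊔ π' (c x)) ≤ M'.f (α x) := by
      rw [hf]
      linarith [hlca i (c x), M.f_mono (sup_le hi (hc x))]
    exact le_sup_left.trans
      (M'.le_of_f_le le_sup_right (M'.le_up _ _ (hlow x _ (hc x))) hsup)
  refine ⟨α, hf, hbelow, fun x₁ x₂ hx => ?_, fun h x₁ x₂ h₁ h₂ hle => ?_⟩
  · refine M'.le_of_f_le (hbelow x₁ _ (hc x₁)) (hbelow x₂ _ ((hc x₁).trans hx)) ?_
    rw [hf, hf]
    linarith [M.f_mono hx]
  · rcases eq_or_ne x₁ x₂ with rfl | hne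
    · exact L'.refl _ _ (by rw [hf, h₁])
    · have hle' := le_up_of_ptLe L' (h₁ ▸ hlow x₁ _ (hc x₁)) (h₂ ▸ hlow x₂ _ (hc x₂))
        (hmono _ _ (not_ptLe_of_le L h₁ h₂ hle hne (hc x₁) (hc x₂)))
      simpa only [hα, h₁, h₂] using hle'

theorem shift_comp_eq_up {α : T → T'} {β : T' → T} (hδ : 0 ≤ δ) (hπ : ∀ x, ∃ i, π i ≤ x)
    (hα : ∀ x, M'.f (α x) = M.f x + δ) (hβ : ∀ y, M.f (β y) = M'.f y + δ)
    (hαπ : ∀ x i, π i ≤ x → π' i ≤ α x) (hβπ : ∀ y i, π' i ≤ y → π i ≤ β y) (x : T) :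
    β (α x) = M.up x (M.f x + 2 * δ) := by
  obtain ⟨i, hi⟩ := hπ x
  have hx : M.f x ≤ M.f x + 2 * δ := by linarith
  refine M.eq_of_f_eq (hβπ _ i (hαπ x i hi)) (hi.trans (M.le_up x _ hx)) ?_
  rw [hβ, hα, M.f_up x _ hx]
  ring

end Shift

end MergeTree

/-- From a monotone `δ`-labelling `(π, π')` between two ordered
merge trees (each with binary least upper bounds `⊔` = lca, and with a leaf
below every point) one obtains a monotone `δ`-interleaving `(α, β)`:
`δ`-shift maps that are order-preserving, whose compositions lift points by
`2δ`, and which are layer-monotone. -/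
theorem monotone_labelling_to_monotone_interleaving
    {T T' : Type*} [SemilatticeSup T] [SemilatticeSup T']
    (M : MergeTree T) (M' : MergeTree T')
    (L : LayerOrder M) (L' : LayerOrder M')
    (hleafT : ∀ x : T, ∃ u : T, IsLeaf u ∧ u ≤ x)
    (hleafT' : ∀ y : T', ∃ u : T', IsLeaf u ∧ u ≤ y)
    (δ : ℝ) (hδ : 0 ≤ δ) (n : ℕ)
    (π : Fin n → T) (π' : Fin n → T')
    (hπ : ∀ u : T, IsLeaf u → ∃ i : Fin n, π i = u)
    (hπ' : ∀ u : T', IsLeaf u → ∃ i : Fin n, π' i = u)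
    (hlab : (⨆ i : Fin n, ⨆ j : Fin n,
      |M.f (π i ⊔ π j) - M'.f (π' i ⊔ π' j)|) = δ)
    (hmono : ∀ i j : Fin n,
      (ptLe M L (π i) (π j) ∧ ¬ ptLe M L (π j) (π i)) →
      ptLe M' L' (π' i) (π' j)) :
    ∃ (α : T → T') (β : T' → T),
      (∀ x : T, M'.f (α x) = M.f x + δ) ∧
      (∀ y : T', M.f (β y) = M'.f y + δ) ∧
      (∀ x1 x2 : T, x1 ≤ x2 → α x1 ≤ α x2) ∧
      (∀ y1 y2 : T', y1 ≤ y2 → β y1 ≤ β y2) ∧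
      (∀ x : T, β (α x) = M.up x (M.f x + 2 * δ)) ∧
      (∀ y : T', α (β y) = M'.up y (M'.f y + 2 * δ)) ∧
      (∀ (h : ℝ) (x1 x2 : T), M.f x1 = h → M.f x2 = h → L.le h x1 x2 →
        L'.le (h + δ) (α x1) (α x2)) ∧
      (∀ (h : ℝ) (y1 y2 : T'), M'.f y1 = h → M'.f y2 = h → L'.le h y1 y2 →
        L.le (h + δ) (β y1) (β y2)) := by
  have hlca : ∀ i j, |M.f (π i ⊔ π j) - M'.f (π' i ⊔ π' j)| ≤ δ := fun i j =>
    ((le_ciSup (Set.finite_range fun j => |M.f (π i ⊔ π j) - M'.f (π' i ⊔ π' j)|).bddAbove j).trans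
      (le_ciSup (Set.finite_range fun i =>
        ⨆ j, |M.f (π i ⊔ π j) - M'.f (π' i ⊔ π' j)|).bddAbove i)).trans_eq hlab
  have hle := MergeTree.exists_label_le hleafT hπ
  have hle' := MergeTree.exists_label_le hleafT' hπ'
  obtain ⟨α, hα, hαπ, hα_mono, hα_layer⟩ := MergeTree.exists_shift (δ := δ) L L' hle
    (fun i j => by linarith [(abs_le.mp (hlca i j)).1])
    fun i j h => hmono i j ⟨(MergeTree.ptLe_total L _ _).resolve_right h, h⟩
  obtain ⟨β, hβ, hβπ, hβ_mono, hβ_layer⟩ := MergeTree.exists_shift (δ := δ) L' L hle'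
    (fun i j => by linarith [(abs_le.mp (hlca i j)).2])
    fun i j h => by
      by_contra hij
      exact h (hmono j i ⟨(MergeTree.ptLe_total L _ _).resolve_right hij, hij⟩)
  exact ⟨α, β, hα, hβ, hα_mono, hβ_mono,
    MergeTree.shift_comp_eq_up hδ hle hα hβ hαπ hβπ,
    MergeTree.shift_comp_eq_up hδ hle' hβ hα hβπ hαπ, hα_layer, hβ_layer⟩
end
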